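/- Let f : ℝⁿ → ℝ be differentiable with L-Lipschitz gradient (L ≥ 0). Let M be an n×d real matrix and G an n×s real matrix with GᵀMMᵀG positive definite and λ_min(GᵀG) > 0. Fix x ∈ ℝⁿ, set λ := −(GᵀMMᵀG)⁻¹GᵀMMᵀ∇f(x) and d_k := −(d/n)·MᵀG(GᵀMMᵀG)⁻¹[−λ]₊. Let ε ∈ (0,1), α ≥ 0, and suppose ‖M d_k‖² ≤ ((1+ε)/n)·‖d_k‖² and λ_min(GᵀMMᵀG) ≥ (d(1−ε)/n²)·λ_min(GᵀG). Then f(x + α·M d_k) ≤ f(x) − (d/n)·(α − L·α²·(1+ε)/(2(1−ε)·λ_min(GᵀG)))·‖[−λ]₊‖². -/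

import Mathlib

open Matrix InnerProductSpace

/-- Apply a real matrix to a vector of the corresponding Euclidean space. -/
noncomputable def mulVecE {m n : Type*} [Fintype n] (A : Matrix m n ℝ)
    (v : EuclideanSpace ℝ n) : EuclideanSpace ℝ m :=
  (WithLp.equiv 2 (m → ℝ)).symm (A.mulVec ((WithLp.equiv 2 (n → ℝ)) v))

/-- `Z = I - MᵀG(GᵀMMᵀG)⁻¹GᵀM`. -/
noncomputable def Zmat {n d s : Type*} [Fintype n] [Fintype d] [DecidableEq d] [Fintype s]
    [DecidableEq s] (M : Matrix n d ℝ) (G : Matrix n s ℝ) : Matrix d d ℝ :=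
  1 - Mᵀ * G * (Gᵀ * M * Mᵀ * G)⁻¹ * Gᵀ * M

/-- `λ(v) = -(GᵀMMᵀG)⁻¹GᵀMMᵀv`. -/
noncomputable def lamVec {n d s : Type*} [Fintype n] [Fintype d] [Fintype s] [DecidableEq s]
    (M : Matrix n d ℝ) (G : Matrix n s ℝ) (v : EuclideanSpace ℝ n) : EuclideanSpace ℝ s :=
  -(mulVecE ((Gᵀ * M * Mᵀ * G)⁻¹ * Gᵀ * M * Mᵀ) v)

/-- Componentwise positive part `[a]₊`. -/
noncomputable def posPartE {s : Type*} (a : EuclideanSpace ℝ s) : EuclideanSpace ℝ s :=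
  (WithLp.equiv 2 (s → ℝ)).symm (fun i => max ((WithLp.equiv 2 (s → ℝ)) a i) 0)

/-- Smallest eigenvalue of a (symmetric) real matrix. -/
noncomputable def lambdaMin {s : Type*} [Fintype s] (A : Matrix s s ℝ) : ℝ :=
  sInf {r : ℝ | ∃ v : s → ℝ, v ≠ 0 ∧ A.mulVec v = r • v}

/-- Quadratic upper bound for a function whose gradient is `L`-Lipschitz. -/
theorem le_add_inner_gradient_add_sq {E : Type*} [NormedAddCommGroup E] [InnerProductSpace ℝ E]
    [CompleteSpace E] {f : E → ℝ} {L : ℝ} (hdiff : Differentiable ℝ f)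
    (hlip : ∀ x y, ‖gradient f x - gradient f y‖ ≤ L * ‖x - y‖) (x u : E) :
    f (x + u) ≤ f x + inner ℝ (gradient f x) u + L / 2 * ‖u‖ ^ 2 := by
  have hderiv (t : ℝ) : HasDerivAt
      (fun t : ℝ => f (x + t • u) - t * inner ℝ (gradient f x) u - L / 2 * ‖u‖ ^ 2 * t ^ 2)
      (inner ℝ (gradient f (x + t • u)) u - inner ℝ (gradient f x) u - L * ‖u‖ ^ 2 * t) t := by
    have hline : HasDerivAt (fun t : ℝ => x + t • u) u t := by
      simpa using ((hasDerivAt_id t).smul_const u).const_add x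
    have hf : HasDerivAt (fun t : ℝ => f (x + t • u)) (inner ℝ (gradient f (x + t • u)) u) t := by
      simpa [Function.comp_def] using
        (hdiff (x + t • u)).hasGradientAt.hasFDerivAt.comp_hasDerivAt t hline
    have hlin := (hasDerivAt_id t).mul_const (inner ℝ (gradient f x) u)
    have hsq := (hasDerivAt_pow 2 t).const_mul (L / 2 * ‖u‖ ^ 2)
    refine ((hf.sub hlin).sub hsq).congr_deriv ?_
    push_cast
    ring
  have hanti := antitoneOn_of_deriv_nonpos (convex_Icc (0 : ℝ) 1)
    (fun t _ => (hderiv t).continuousAt.continuousWithinAt)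
    (fun t _ => (hderiv t).differentiableAt.differentiableWithinAt) (fun t ht => by
      rw [interior_Icc] at ht
      rw [(hderiv t).deriv, ← inner_sub_left]
      have hnorm : ‖gradient f (x + t • u) - gradient f x‖ ≤ L * (t * ‖u‖) := by
        simpa [norm_smul, abs_of_pos ht.1] using hlip (x + t • u) x
      nlinarith [real_inner_le_norm (gradient f (x + t • u) - gradient f x) u,
        mul_le_mul_of_nonneg_right hnorm (norm_nonneg u)])
  have h := hanti (Set.left_mem_Icc.2 zero_le_one) (Set.right_mem_Icc.2 zero_le_one) zero_le_one
  simp only [one_smul, zero_smul, add_zero] at h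
  linarith

theorem lambdaMin_mul_dotProduct_self_le {s : Type*} [Fintype s] [DecidableEq s]
    {A : Matrix s s ℝ} (hA : A.PosSemidef) (v : s → ℝ) :
    lambdaMin A * (v ⬝ᵥ v) ≤ v ⬝ᵥ A *ᵥ v := by
  have hbdd : BddBelow {r : ℝ | ∃ v : s → ℝ, v ≠ 0 ∧ A.mulVec v = r • v} := by
    refine ⟨0, ?_⟩
    rintro r ⟨w, hw, hAw⟩
    have h := hA.dotProduct_mulVec_nonneg w
    rw [hAw, dotProduct_smul, star_trivial, smul_eq_mul] at h
    exact nonneg_of_mul_nonneg_left h (by simpa using dotProduct_star_self_pos_iff.2 hw)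
  have hherm : (A - lambdaMin A • (1 : Matrix s s ℝ)).IsHermitian :=
    hA.isHermitian.sub (by simp [Matrix.IsHermitian])
  have hpsd : (A - lambdaMin A • (1 : Matrix s s ℝ)).PosSemidef := by
    rw [hherm.posSemidef_iff_eigenvalues_nonneg]
    intro i
    have heig := hherm.mulVec_eigenvectorBasis i
    rw [Matrix.sub_mulVec, Matrix.smul_mulVec, Matrix.one_mulVec, sub_eq_iff_eq_add,
      ← add_smul] at heig
    have hne : (hherm.eigenvectorBasis i).ofLp ≠ 0 := fun h =>
      hherm.eigenvectorBasis.toBasis.ne_zero i (by simpa using h)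
    have hle : lambdaMin A ≤ hherm.eigenvalues i + lambdaMin A := csInf_le hbdd ⟨_, hne, heig⟩
    simpa using hle
  have h := hpsd.dotProduct_mulVec_nonneg v
  rw [Matrix.sub_mulVec, Matrix.smul_mulVec, Matrix.one_mulVec, dotProduct_sub, dotProduct_smul,
    star_trivial, smul_eq_mul] at h
  linarith

theorem lambdaMin_mul_dotProduct_inv_mulVec_le {s : Type*} [Fintype s] [DecidableEq s]
    {A : Matrix s s ℝ} (hA : A.PosDef) (p : s → ℝ) :
    lambdaMin A * (p ⬝ᵥ A⁻¹ *ᵥ p) ≤ p ⬝ᵥ p := by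
  have hAw : A *ᵥ A⁻¹ *ᵥ p = p := by
    rw [Matrix.mulVec_mulVec, Matrix.mul_nonsing_inv _ hA.det_pos.ne'.isUnit, Matrix.one_mulVec]
  have hray := lambdaMin_mul_dotProduct_self_le hA.posSemidef (A⁻¹ *ᵥ p)
  rw [hAw, dotProduct_comm (A⁻¹ *ᵥ p) p] at hray
  have hnonneg : 0 ≤ p ⬝ᵥ A⁻¹ *ᵥ p := by
    simpa using hA.inv.posSemidef.dotProduct_mulVec_nonneg p
  set w := A⁻¹ *ᵥ p
  rcases le_or_gt (lambdaMin A) 0 with hl | hl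
  · exact (mul_nonpos_of_nonpos_of_nonneg hl hnonneg).trans
      (by simpa using dotProduct_star_self_nonneg p)
  · have h : 0 ≤ (p - lambdaMin A • w) ⬝ᵥ (p - lambdaMin A • w) := by
      simpa using dotProduct_star_self_nonneg (p - lambdaMin A • w)
    simp only [sub_dotProduct, dotProduct_sub, smul_dotProduct, dotProduct_smul,
      smul_eq_mul, dotProduct_comm w p] at h
    nlinarith [mul_le_mul_of_nonneg_left hray hl.le]

theorem inner_posPartE_self {s : Type*} [Fintype s] (a : EuclideanSpace ℝ s) :
    inner ℝ (posPartE a) a = ‖posPartE a‖ ^ 2 := by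
  rw [← real_inner_self_eq_norm_sq]
  simp only [PiLp.inner_apply, posPartE]
  refine Finset.sum_congr rfl fun i _ => ?_
  rcases le_total (a i) 0 with h | h <;> simp [h]

theorem mulVecE_mulVecE {l m n : Type*} [Fintype m] [Fintype n] (A : Matrix l m ℝ)
    (B : Matrix m n ℝ) (v : EuclideanSpace ℝ n) :
    mulVecE A (mulVecE B v) = mulVecE (A * B) v := by
  simp [mulVecE, Matrix.mulVec_mulVec]

theorem inner_mulVecE_right {m n : Type*} [Fintype m] [Fintype n] (A : Matrix m n ℝ)
    (u : EuclideanSpace ℝ m) (v : EuclideanSpace ℝ n) :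
    inner ℝ u (mulVecE A v) = inner ℝ (mulVecE Aᵀ u) v := by
  simp [mulVecE, EuclideanSpace.inner_eq_star_dotProduct, Matrix.mulVec_transpose,
    dotProduct_comm, Matrix.dotProduct_mulVec]

theorem mulVecE_neg_smul {m n : Type*} [Fintype n] (A : Matrix m n ℝ) (c : ℝ)
    (v : EuclideanSpace ℝ n) : mulVecE A (-(c • v)) = -(c • mulVecE A v) := by
  simp [mulVecE, Matrix.mulVec_neg, Matrix.mulVec_smul]

theorem lambdaMin_mul_inner_mulVecE_inv_le {s : Type*} [Fintype s] [DecidableEq s]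
    {A : Matrix s s ℝ} (hA : A.PosDef) (p : EuclideanSpace ℝ s) :
    lambdaMin A * inner ℝ p (mulVecE A⁻¹ p) ≤ ‖p‖ ^ 2 := by
  rw [← real_inner_self_eq_norm_sq]
  simp only [mulVecE, EuclideanSpace.inner_eq_star_dotProduct, star_trivial]
  rw [dotProduct_comm]
  exact lambdaMin_mul_dotProduct_inv_mulVec_le hA p.ofLp

theorem stmt5 {n d s : ℕ} (hn : 0 < n) (hd : 0 < d) (hs : 0 < s)
    (f : EuclideanSpace ℝ (Fin n) → ℝ) (L : ℝ) (hL : 0 ≤ L)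
    (hdiff : Differentiable ℝ f)
    (hlip : ∀ x y, ‖gradient f x - gradient f y‖ ≤ L * ‖x - y‖)
    (M : Matrix (Fin n) (Fin d) ℝ) (G : Matrix (Fin n) (Fin s) ℝ)
    (hpd : (Gᵀ * M * Mᵀ * G).PosDef)
    (hGG : 0 < lambdaMin (Gᵀ * G))
    (x : EuclideanSpace ℝ (Fin n)) (ε α : ℝ)
    (hε0 : 0 < ε) (hε1 : ε < 1) (hα : 0 ≤ α)
    (dk : EuclideanSpace ℝ (Fin d))
    (hdk : dk = -(((d : ℝ) / n) • mulVecE (Mᵀ * G * (Gᵀ * M * Mᵀ * G)⁻¹)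
        (posPartE (-(lamVec M G (gradient f x))))))
    (hMdk : ‖mulVecE M dk‖ ^ 2 ≤ ((1 + ε) / n) * ‖dk‖ ^ 2)
    (heig : ((d : ℝ) * (1 - ε) / n ^ 2) * lambdaMin (Gᵀ * G)
        ≤ lambdaMin (Gᵀ * M * Mᵀ * G)) :
    f (x + α • mulVecE M dk)
      ≤ f x - ((d : ℝ) / n) * (α - L * α ^ 2 * (1 + ε) / (2 * (1 - ε) * lambdaMin (Gᵀ * G)))
          * ‖posPartE (-(lamVec M G (gradient f x)))‖ ^ 2 := by
  set H := Gᵀ * M * Mᵀ * G with hH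
  set g := gradient f x
  set p := posPartE (-(lamVec M G g))
  have hn' : (0 : ℝ) < n := by exact_mod_cast hn
  have hd' : (0 : ℝ) < d := by exact_mod_cast hd
  have hε : 0 < 1 - ε := by linarith
  have hHT : H⁻¹ᵀ = H⁻¹ := by simpa using hpd.inv.isHermitian.eq
  have hlam : mulVecE (H⁻¹ * Gᵀ * M * Mᵀ) g = -(lamVec M G g) := (neg_neg _).symm
  have hmat_slope : (M * (Mᵀ * G * H⁻¹))ᵀ = H⁻¹ * Gᵀ * M * Mᵀ := by
    simp only [Matrix.transpose_mul, Matrix.transpose_transpose, hHT, Matrix.mul_assoc]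
  have hslope : inner ℝ g (mulVecE M dk) = -((d : ℝ) / n * ‖p‖ ^ 2) := by
    rw [← inner_posPartE_self (-(lamVec M G g)), hdk, mulVecE_neg_smul, mulVecE_mulVecE,
      inner_neg_right, inner_smul_right, inner_mulVecE_right, hmat_slope, hlam,
      real_inner_comm]
  have hnorm : ‖dk‖ ^ 2 = ((d : ℝ) / n) ^ 2 * inner ℝ p (mulVecE H⁻¹ p) := by
    have hmat : (Mᵀ * G * H⁻¹)ᵀ * (Mᵀ * G * H⁻¹) = H⁻¹ := by
      have hassoc : (Mᵀ * G * H⁻¹)ᵀ * (Mᵀ * G * H⁻¹) = H⁻¹ * H * H⁻¹ := by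
        rw [Matrix.transpose_mul, hHT, hH]
        simp only [Matrix.transpose_mul, Matrix.transpose_transpose, Matrix.mul_assoc]
      rw [hassoc, Matrix.nonsing_inv_mul _ hpd.det_pos.ne'.isUnit, Matrix.one_mul]
    rw [hdk, norm_neg, norm_smul, mul_pow, Real.norm_eq_abs, sq_abs,
      ← real_inner_self_eq_norm_sq, inner_mulVecE_right, mulVecE_mulVecE, hmat, real_inner_comm]
  have hdk_le : (1 - ε) * lambdaMin (Gᵀ * G) * ‖dk‖ ^ 2 ≤ d * ‖p‖ ^ 2 := by
    have hq : 0 ≤ inner ℝ p (mulVecE H⁻¹ p) :=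
      nonneg_of_mul_nonneg_right (hnorm ▸ sq_nonneg ‖dk‖) (by positivity)
    calc (1 - ε) * lambdaMin (Gᵀ * G) * ‖dk‖ ^ 2
        = d * (d * (1 - ε) / n ^ 2 * lambdaMin (Gᵀ * G) * inner ℝ p (mulVecE H⁻¹ p)) := by
          rw [hnorm]; field_simp
      _ ≤ d * (lambdaMin H * inner ℝ p (mulVecE H⁻¹ p)) := by gcongr
      _ ≤ d * ‖p‖ ^ 2 := by gcongr; exact lambdaMin_mul_inner_mulVecE_inv_le hpd p
  have hMdk_le : ‖mulVecE M dk‖ ^ 2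
      ≤ (1 + ε) / n * (d * ‖p‖ ^ 2 / ((1 - ε) * lambdaMin (Gᵀ * G))) := by
    refine hMdk.trans ?_
    gcongr
    rw [le_div_iff₀ (by positivity)]
    linarith
  have hdesc := le_add_inner_gradient_add_sq hdiff hlip x (α • mulVecE M dk)
  rw [inner_smul_right, hslope, norm_smul, mul_pow, Real.norm_eq_abs, sq_abs] at hdesc
  calc f (x + α • mulVecE M dk)
      ≤ f x + α * -(d / n * ‖p‖ ^ 2) + L / 2 * (α ^ 2 * ‖mulVecE M dk‖ ^ 2) := hdesc
    _ ≤ f x + α * -(d / n * ‖p‖ ^ 2) + L / 2 * (α ^ 2 *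
          ((1 + ε) / n * (d * ‖p‖ ^ 2 / ((1 - ε) * lambdaMin (Gᵀ * G))))) := by gcongr
    _ = _ := by field_simp; ring
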